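/- For any two permutations σ and π, μ(σ,π) = (−1)^{|π|−|σ|}·E(σ,π) − ∑_{λ∈[σ,π)} μ(σ,λ) · ∑_{τ∈[λ,π]} (−1)^{|π|−|τ|}·E(τ,π), where E(α,β) denotes the number of embeddings of α into β and [σ,π) denotes the half-open interval {λ : σ≤λ≤π, λ≠π}. -/

import Mathlib

open scoped Classical

noncomputable section

/-- A finite permutation: a size `n` together with a permutation of `Fin n`.
Positions and values are 0-indexed here; the paper's 1-indexed sequence
`π(1), …, π(n)` corresponds to the map `p ↦ π(p+1) - 1`. -/
abbrev PPerm : Type := Σ n : ℕ, Equiv.Perm (Fin n)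

namespace PPerm

/-- `IsEmb σ π f` : `f` is an embedding of the permutation `σ` into the permutation `π`,
i.e. `f` is strictly increasing and the values of `π` along `f` are ordered as the values
of `σ`. -/
def IsEmb (σ π : PPerm) (f : Fin σ.1 → Fin π.1) : Prop :=
  StrictMono f ∧ ∀ i j : Fin σ.1, σ.2 i < σ.2 j ↔ π.2 (f i) < π.2 (f j)

/-- The pattern-containment order on finite permutations: `Le σ π` iff some embedding
of `σ` into `π` exists. -/
def Le (σ π : PPerm) : Prop := ∃ f, IsEmb σ π f

lemma Le.size_le {σ π : PPerm} (h : Le σ π) : σ.1 ≤ π.1 := by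
  obtain ⟨f, hf⟩ := h
  simpa using Fintype.card_le_of_injective f hf.1.injective

lemma strictMono_fin_eq_id {n : ℕ} {f : Fin n → Fin n} (hf : StrictMono f) : f = id := by
  have hsurj : Function.Surjective f := Finite.surjective_of_injective hf.injective
  have he : (StrictMono.orderIsoOfSurjective f hf hsurj) = OrderIso.refl (Fin n) :=
    Subsingleton.elim _ _
  funext i
  have h2 := congrArg (fun e : Fin n ≃o Fin n => e i) he
  simpa using h2

lemma Le.eq_of_size_eq {σ π : PPerm} (h : Le σ π) (hs : σ.1 = π.1) : σ = π := by
  obtain ⟨n, s⟩ := σ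
  obtain ⟨n', p⟩ := π
  simp only at hs
  subst hs
  obtain ⟨f, hf, hpat⟩ := h
  have hid : f = id := strictMono_fin_eq_id hf
  subst hid
  have key : ∀ i j, s i < s j ↔ p i < p j := by simpa using hpat
  have hF : StrictMono (fun u => p (s.symm u)) := by
    intro u v huv
    have h1 : s (s.symm u) < s (s.symm v) := by simpa using huv
    exact (key _ _).mp h1
  have hFid : (fun u => p (s.symm u)) = id := strictMono_fin_eq_id hF
  have hps : ∀ w, p w = s w := by
    intro w
    have := congrFun hFid (s w)
    simpa using this
  have : p = s := Equiv.ext hps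
  subst this
  rfl

/-- All permutations of size `k`, as a finite set. -/
def permsOfSize (k : ℕ) : Finset PPerm :=
  Finset.univ.image (fun p : Equiv.Perm (Fin k) => (⟨k, p⟩ : PPerm))

/-- All permutations of size at most `N`, as a finite set. -/
def permsUpTo (N : ℕ) : Finset PPerm :=
  (Finset.range (N + 1)).biUnion permsOfSize

lemma size_le_of_mem_permsUpTo {N : ℕ} {z : PPerm} (h : z ∈ permsUpTo N) : z.1 ≤ N := by
  simp only [permsUpTo, permsOfSize, Finset.mem_biUnion, Finset.mem_range,
    Finset.mem_image, Finset.mem_univ, true_and] at h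
  obtain ⟨k, hk, p, rfl⟩ := h
  show k ≤ N
  omega

/-- The Möbius function of the pattern-containment poset of permutations:
`mu x y = 0` if `x ≰ y`, `mu x x = 1`, and `mu x y = -∑_{z ∈ [x,y)} mu x z` if `x < y`,
where `[x,y)` is the (finite) set of permutations `z` with `x ≤ z ≤ y` and `z ≠ y`. -/
def mu (x y : PPerm) : ℤ :=
  if x = y then 1
  else if ¬ Le x y then 0
  else - ∑ z ∈ ((permsUpTo y.1).filter (fun z => Le x z ∧ Le z y ∧ z ≠ y)).attach,
      mu x z.1
termination_by y.1
decreasing_by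
  have hz := z.2
  rw [Finset.mem_filter] at hz
  obtain ⟨hmem, _, hzy, hne⟩ := hz
  have h1 : z.1.1 ≤ y.1 := size_le_of_mem_permsUpTo hmem
  rcases lt_or_eq_of_le h1 with h | h
  · exact h
  · exact absurd (hzy.eq_of_size_eq h) hne

/-- The closed interval `[x,y]` in the pattern-containment poset, as a finite set. -/
def Icc (x y : PPerm) : Finset PPerm :=
  (permsUpTo y.1).filter (fun z => Le x z ∧ Le z y)

/-- The half-open interval `[x,y)` in the pattern-containment poset, as a finite set. -/
def Ico (x y : PPerm) : Finset PPerm :=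
  (Icc x y).filter (fun z => z ≠ y)

/-- `E σ π` : the number of embeddings of `σ` into `π`. -/
def E (σ π : PPerm) : ℕ := Nat.card {f : Fin σ.1 → Fin π.1 // IsEmb σ π f}

/-- A normal embedding: an embedding whose image contains every non-initial position of
every adjacency of `π`. (A position `p` is a non-initial position of an adjacency of `π`
iff it has an immediate predecessor `q` with `π p = π q + 1`.) -/
def IsNormalEmb (σ π : PPerm) (f : Fin σ.1 → Fin π.1) : Prop :=
  IsEmb σ π f ∧
    ∀ p q : Fin π.1, (p : ℕ) = (q : ℕ) + 1 → ((π.2 p : ℕ) = (π.2 q : ℕ) + 1) →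
      p ∈ Set.range f

/-- `NE σ π` : the number of normal embeddings of `σ` into `π`. -/
def NE (σ π : PPerm) : ℕ := Nat.card {f : Fin σ.1 → Fin π.1 // IsNormalEmb σ π f}

/-- The number of inverse descents of `π`: pairs of positions `i < j` with
`π(i) = π(j) + 1`. -/
def ides (π : PPerm) : ℕ :=
  Nat.card {p : Fin π.1 × Fin π.1 // p.1 < p.2 ∧ ((π.2 p.1 : ℕ) = (π.2 p.2 : ℕ) + 1)}

/-- The unique permutation of size 1. -/
def one : PPerm := ⟨1, Equiv.refl _⟩

/-- The permutation `12`. -/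
def perm12 : PPerm := ⟨2, Equiv.refl _⟩

/-- The decreasing permutation `δ_k = k, k-1, …, 1`. -/
def delta (k : ℕ) : PPerm := ⟨k, Fin.revPerm⟩

/-- The permutation `21`. -/
def perm21 : PPerm := delta 2

/-- The value of `π_n` at the 1-indexed position `i ∈ [1, 2n+2]` (as a 1-indexed value):
`π_n = n+1, 1, n+3, 2, n+4, 3, …, n, 2n+2, n+2`. -/
def piVal (n i : ℕ) : ℕ :=
  if i = 1 then n + 1
  else if i = 2 * n + 2 then n + 2
  else if i % 2 = 0 then i / 2
  else n + 2 + i / 2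

/-- The 1-indexed position of the 1-indexed value `v` in `π_n`. -/
def piValInv (n v : ℕ) : ℕ :=
  if v = n + 1 then 1
  else if v = n + 2 then 2 * n + 2
  else if v ≤ n then 2 * v
  else 2 * (v - n - 2) + 1

/-- The permutation `π_n` as a permutation of `Fin (2n+2)` (0-indexed). -/
def piEquiv (n : ℕ) : Equiv.Perm (Fin (2 * n + 2)) where
  toFun p := ⟨piVal n (p.1 + 1) - 1, by
    have := p.2; unfold piVal; split_ifs <;> omega⟩
  invFun v := ⟨piValInv n (v.1 + 1) - 1, by
    have := v.2; unfold piValInv; split_ifs <;> omega⟩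
  left_inv p := by
    have := p.2
    apply Fin.ext
    show piValInv n (piVal n (p.1 + 1) - 1 + 1) - 1 = p.1
    unfold piVal piValInv
    split_ifs <;> omega
  right_inv v := by
    have := v.2
    apply Fin.ext
    show piVal n (piValInv n (v.1 + 1) - 1 + 1) - 1 = v.1
    unfold piVal piValInv
    split_ifs <;> omega

/-- `π_n` as an element of the permutation poset; it has size `2n+2`. -/
def piPerm (n : ℕ) : PPerm := ⟨2 * n + 2, piEquiv n⟩

/-- `p` is a top position of `π_n`: it carries one of the values `n+3, …, 2n+2`
(1-indexed), i.e. one of the 0-indexed values `n+2, …, 2n+1`. -/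
def piTopPos (n : ℕ) (p : Fin (2 * n + 2)) : Prop := n + 2 ≤ ((piEquiv n) p : ℕ)

/-- `p` is a bottom position of `π_n`: it carries one of the values `1, …, n`
(1-indexed), i.e. one of the 0-indexed values `0, …, n-1`. -/
def piBotPos (n : ℕ) (p : Fin (2 * n + 2)) : Prop := ((piEquiv n) p : ℕ) < n

/-- `k` is a top position of `lam`: for a permutation `lam` with a unique inverse
descent `(i,j)` this says `lam k ≥ lam i`. -/
def IsTopPos (lam : PPerm) (k : Fin lam.1) : Prop :=
  ∃ i j : Fin lam.1, i < j ∧ ((lam.2 i : ℕ) = (lam.2 j : ℕ) + 1) ∧ lam.2 i ≤ lam.2 k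

/-- `k` is a bottom position of `lam`: for a permutation `lam` with a unique inverse
descent `(i,j)` this says `lam k ≤ lam j`. -/
def IsBotPos (lam : PPerm) (k : Fin lam.1) : Prop :=
  ∃ i j : Fin lam.1, i < j ∧ ((lam.2 i : ℕ) = (lam.2 j : ℕ) + 1) ∧ lam.2 k ≤ lam.2 j

/-- A top repetition of `lam` at position `k`: positions `k` and `k+1` are both
top positions. -/
def IsTopRep (lam : PPerm) (k : Fin lam.1) : Prop :=
  ∃ h : (k : ℕ) + 1 < lam.1, IsTopPos lam k ∧ IsTopPos lam ⟨(k : ℕ) + 1, h⟩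

/-- A bottom repetition of `lam` at position `k`: positions `k` and `k+1` are both
bottom positions. -/
def IsBotRep (lam : PPerm) (k : Fin lam.1) : Prop :=
  ∃ h : (k : ℕ) + 1 < lam.1, IsBotPos lam k ∧ IsBotPos lam ⟨(k : ℕ) + 1, h⟩

/-- `lam` is a proper permutation with respect to `π_n`. -/
def IsProper (n : ℕ) (lam : PPerm) : Prop :=
  Le perm21 lam ∧ Le lam (piPerm n) ∧ lam ≠ piPerm n ∧
  ides lam = 1 ∧
  (∀ k : Fin lam.1, (k : ℕ) = 0 → IsTopPos lam k) ∧
  (∀ k : Fin lam.1, (k : ℕ) = 1 → IsBotPos lam k) ∧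
  (∀ k : Fin lam.1, (k : ℕ) = lam.1 - 2 → IsTopPos lam k) ∧
  (∀ k : Fin lam.1, (k : ℕ) = lam.1 - 1 → IsBotPos lam k) ∧
  Nat.card {k : Fin lam.1 // IsTopRep lam k} ≤ 1 ∧
  Nat.card {k : Fin lam.1 // IsBotRep lam k} ≤ 1 ∧
  (∀ k l : Fin lam.1, IsTopRep lam k → IsBotRep lam l → k < l)

/-- `S_lam = ∑_{τ ∈ [lam, π_n]} (-1)^{|τ|} E(τ, π_n)`. -/
def Svals (n : ℕ) (lam : PPerm) : ℤ :=
  ∑ τ ∈ Icc lam (piPerm n), (-1 : ℤ) ^ τ.1 * (E τ (piPerm n) : ℤ)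

/-- `lam` is vanishing (with respect to `π_n`): `μ(21, lam) · S_lam = 0`. -/
def Vanishing (n : ℕ) (lam : PPerm) : Prop := mu perm21 lam * Svals n lam = 0

/-- The reverse-complement of a permutation. -/
def rc (lam : PPerm) : PPerm := ⟨lam.1, (Fin.revPerm.trans lam.2).trans Fin.revPerm⟩

/-- The cup of size `m`: the permutation `(m-1), 1, 2, …, (m-2), m`. -/
def IsCup (lam : PPerm) : Prop :=
  ∀ k : Fin lam.1, (lam.2 k : ℕ) =
    if (k : ℕ) = 0 then lam.1 - 2 else if (k : ℕ) = lam.1 - 1 then lam.1 - 1 else (k : ℕ) - 1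

/-- The cap of size `m`: the permutation `1, 3, 4, …, m, 2`. -/
def IsCap (lam : PPerm) : Prop :=
  ∀ k : Fin lam.1, (lam.2 k : ℕ) =
    if (k : ℕ) = 0 then 0 else if (k : ℕ) = lam.1 - 1 then 1 else (k : ℕ) + 1

/-- `LexLt f f'` : `f` is lexicographically smaller than `f'`, i.e. `f i < f' i` at the
smallest index `i` where they differ. -/
def LexLt {m N : ℕ} (f f' : Fin m → Fin N) : Prop :=
  ∃ i : Fin m, f i < f' i ∧ ∀ j : Fin m, j < i → f j = f' j

/-- `f` is the rightmost (lexicographically greatest) embedding of `lam` into `π_n`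
with image contained in `T`. -/
def IsRightmostIn (n : ℕ) (lam : PPerm) (f : Fin lam.1 → Fin (2 * n + 2))
    (T : Finset (Fin (2 * n + 2))) : Prop :=
  IsEmb lam (piPerm n) f ∧ (∀ i, f i ∈ T) ∧
    ∀ f' : Fin lam.1 → Fin (2 * n + 2), IsEmb lam (piPerm n) f' → (∀ i, f' i ∈ T) →
      f' ≠ f → LexLt f' f

/-- `S_f = ∑_g (-1)^{|g|}`, the sum over all embeddings `g` into `π_n` (of permutations
`τ` with `lam ≤ τ ≤ π_n`) such that `f` is the rightmost embedding of `lam` compatible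
with `g`. Embeddings into `π_n` are identified with their images, which are subsets of
`Fin (2n+2)`. -/
def Sf (n : ℕ) (lam : PPerm) (f : Fin lam.1 → Fin (2 * n + 2)) : ℤ :=
  ∑ T ∈ Finset.univ.filter (fun T : Finset (Fin (2 * n + 2)) => IsRightmostIn n lam f T),
    (-1 : ℤ) ^ T.card

/-- `f` is greedy in a set `S` of positions of `π_n` (for a proper permutation `lam`):
the last element of `lam` goes to the largest bottom-or-right position of `S`, every other
top element of `lam` goes to the largest left-or-top position of `S` below the image of
the next element, and every other bottom element of `lam` goes to the largest bottom
position of `S` below the image of the next element. -/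
def IsGreedyIn (n : ℕ) (lam : PPerm) (S : Set (Fin (2 * n + 2)))
    (f : Fin lam.1 → Fin (2 * n + 2)) : Prop :=
  (∀ i : Fin lam.1, (i : ℕ) = lam.1 - 1 →
    IsGreatest {p : Fin (2 * n + 2) | p ∈ S ∧ (piBotPos n p ∨ (p : ℕ) = 2 * n + 1)} (f i)) ∧
  (∀ (i : Fin lam.1) (hi : (i : ℕ) + 1 < lam.1), IsTopPos lam i →
    IsGreatest {p : Fin (2 * n + 2) |
      p ∈ S ∧ ((p : ℕ) = 0 ∨ piTopPos n p) ∧ p < f ⟨(i : ℕ) + 1, hi⟩} (f i)) ∧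
  (∀ (i : Fin lam.1) (hi : (i : ℕ) + 1 < lam.1), IsBotPos lam i →
    IsGreatest {p : Fin (2 * n + 2) |
      p ∈ S ∧ piBotPos n p ∧ p < f ⟨(i : ℕ) + 1, hi⟩} (f i))

/-- `f` is almost greedy in `S`: `S` contains the rightmost position of `π_n` and `f` is
greedy in `S` with the rightmost position removed. -/
def IsAlmostGreedyIn (n : ℕ) (lam : PPerm) (S : Set (Fin (2 * n + 2)))
    (f : Fin lam.1 → Fin (2 * n + 2)) : Prop :=
  Fin.last (2 * n + 1) ∈ S ∧ IsGreedyIn n lam (S \ {Fin.last (2 * n + 1)}) f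

/-- The value of Smith's permutation `n+1, 1, n+2, 2, …, 2n, n` at the 1-indexed
position `i ∈ [1, 2n]`, as a 1-indexed value: `π(2i-1) = n+i` and `π(2i) = i`. -/
def sVal (n i : ℕ) : ℕ := if i % 2 = 1 then n + (i + 1) / 2 else i / 2

/-- The 1-indexed position of the 1-indexed value `v` in Smith's permutation. -/
def sValInv (n v : ℕ) : ℕ := if v ≤ n then 2 * v else 2 * (v - n) - 1

/-- Smith's permutation `n+1, 1, n+2, 2, …, 2n, n` as a permutation of `Fin (2n)`. -/
def sEquiv (n : ℕ) : Equiv.Perm (Fin (2 * n)) where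
  toFun p := ⟨sVal n (p.1 + 1) - 1, by have := p.2; unfold sVal; split_ifs <;> omega⟩
  invFun v := ⟨sValInv n (v.1 + 1) - 1, by have := v.2; unfold sValInv; split_ifs <;> omega⟩
  left_inv p := by
    have := p.2
    apply Fin.ext
    show sValInv n (sVal n (p.1 + 1) - 1 + 1) - 1 = p.1
    unfold sVal sValInv
    split_ifs <;> omega
  right_inv v := by
    have := v.2
    apply Fin.ext
    show sVal n (sValInv n (v.1 + 1) - 1 + 1) - 1 = v.1
    unfold sVal sValInv
    split_ifs <;> omega

/-- Smith's permutation as an element of the permutation poset; it has size `2n`. -/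
def smithPerm (n : ℕ) : PPerm := ⟨2 * n, sEquiv n⟩

lemma IsEmb.comp {σ τ π : PPerm} {f : Fin σ.1 → Fin τ.1} {g : Fin τ.1 → Fin π.1}
    (hg : IsEmb τ π g) (hf : IsEmb σ τ f) : IsEmb σ π (g ∘ f) :=
  ⟨hg.1.comp hf.1, fun i j => (hf.2 i j).trans (hg.2 _ _)⟩

lemma isEmb_id (π : PPerm) : IsEmb π π id := ⟨strictMono_id, fun _ _ => Iff.rfl⟩

lemma Le.refl (π : PPerm) : Le π π := ⟨id, isEmb_id π⟩

lemma Le.trans {σ τ π : PPerm} (h₁ : Le σ τ) (h₂ : Le τ π) : Le σ π := by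
  obtain ⟨f, hf⟩ := h₁
  obtain ⟨g, hg⟩ := h₂
  exact ⟨g ∘ f, hg.comp hf⟩

lemma mem_permsUpTo {N : ℕ} {z : PPerm} : z ∈ permsUpTo N ↔ z.1 ≤ N := by
  refine ⟨size_le_of_mem_permsUpTo, fun h => ?_⟩
  simp only [permsUpTo, permsOfSize, Finset.mem_biUnion, Finset.mem_range,
    Finset.mem_image, Finset.mem_univ, true_and]
  exact ⟨z.1, by omega, z.2, rfl⟩

lemma mem_Icc {x y z : PPerm} : z ∈ Icc x y ↔ Le x z ∧ Le z y := by
  simp only [Icc, Finset.mem_filter, mem_permsUpTo, and_iff_right_iff_imp]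
  exact fun h => h.2.size_le

lemma mem_Ico {x y z : PPerm} : z ∈ Ico x y ↔ Le x z ∧ Le z y ∧ z ≠ y := by
  simp only [Ico, Finset.mem_filter, mem_Icc, and_assoc]

lemma mu_self (x : PPerm) : mu x x = 1 := by
  rw [mu, if_pos rfl]

lemma mu_of_not_le {x y : PPerm} (h : ¬ Le x y) : mu x y = 0 := by
  have hne : x ≠ y := fun he => h (he ▸ Le.refl x)
  rw [mu, if_neg hne, if_pos h]

lemma mu_of_ne_of_le {x y : PPerm} (hne : x ≠ y) (h : Le x y) :
    mu x y = - ∑ z ∈ Ico x y, mu x z := by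
  rw [mu, if_neg hne, if_neg (not_not.mpr h), Finset.sum_attach _ (fun z => mu x z)]
  congr 1
  refine Finset.sum_congr ?_ fun _ _ => rfl
  ext z
  simp only [Finset.mem_filter, mem_permsUpTo, mem_Ico, and_iff_right_iff_imp]
  exact fun hz => hz.2.1.size_le

lemma Icc_eq_insert_Ico {x y : PPerm} (h : Le x y) : Icc x y = insert y (Ico x y) := by
  ext z
  simp only [Finset.mem_insert, mem_Icc, mem_Ico]
  by_cases hz : z = y
  · subst hz
    simp [h, Le.refl]
  · simp [hz]

lemma sum_Icc_eq_add_sum_Ico {x y : PPerm} (h : Le x y) (f : PPerm → ℤ) :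
    ∑ z ∈ Icc x y, f z = f y + ∑ z ∈ Ico x y, f z := by
  rw [Icc_eq_insert_Ico h, Finset.sum_insert (by simp [mem_Ico])]

lemma Icc_self (x : PPerm) : Icc x x = {x} := by
  ext z
  simp only [mem_Icc, Finset.mem_singleton]
  constructor
  · rintro ⟨h₁, h₂⟩
    exact h₂.eq_of_size_eq (le_antisymm h₂.size_le h₁.size_le)
  · rintro rfl
    exact ⟨Le.refl z, Le.refl z⟩

lemma sum_Icc_mu {x y : PPerm} (h : Le x y) :
    ∑ z ∈ Icc x y, mu x z = if y = x then 1 else 0 := by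
  split_ifs with hxy
  · subst hxy
    simp [Icc_self, mu_self]
  · rw [sum_Icc_eq_add_sum_Ico h, mu_of_ne_of_le (Ne.symm hxy) h, neg_add_cancel]

/-- Möbius inversion on the interval `[x, y]`. -/
lemma sum_mu_mul_sum_Icc {x y : PPerm} (h : Le x y) (F : PPerm → ℤ) :
    ∑ l ∈ Icc x y, mu x l * ∑ t ∈ Icc l y, F t = F x := by
  simp_rw [Finset.mul_sum]
  rw [Finset.sum_comm' (t' := Icc x y) (s' := fun t => Icc x t)]
  · simp_rw [← Finset.sum_mul]
    rw [Finset.sum_congr rfl fun t ht => by rw [sum_Icc_mu (mem_Icc.mp ht).1]]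
    simp [mem_Icc, h, Le.refl]
  · intro l t
    simp only [mem_Icc]
    exact ⟨fun ⟨⟨h₁, _⟩, h₃, h₄⟩ => ⟨⟨h₁, h₃⟩, h₁.trans h₃, h₄⟩,
      fun ⟨⟨h₁, h₂⟩, _, h₄⟩ => ⟨⟨h₁, h₂.trans h₄⟩, h₂, h₄⟩⟩

lemma E_self (π : PPerm) : E π π = 1 := by
  rw [E, Nat.card_eq_one_iff_unique]
  exact ⟨⟨fun f g => Subtype.ext
    ((strictMono_fin_eq_id f.2.1).trans (strictMono_fin_eq_id g.2.1).symm)⟩, ⟨id, isEmb_id π⟩⟩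

lemma E_of_not_le {σ π : PPerm} (h : ¬ Le σ π) : E σ π = 0 := by
  have : IsEmpty {f : Fin σ.1 → Fin π.1 // IsEmb σ π f} := ⟨fun f => h ⟨f.1, f.2⟩⟩
  rw [E, Nat.card_of_isEmpty]

/-- For any two permutations `σ` and `π`,
`μ(σ,π) = (-1)^{|π|-|σ|} E(σ,π) - ∑_{λ ∈ [σ,π)} μ(σ,λ) ∑_{τ ∈ [λ,π]} (-1)^{|π|-|τ|} E(τ,π)`. -/
theorem mu_eq_embedding_sum (σ π : PPerm) :
    mu σ π = (-1 : ℤ) ^ (π.1 - σ.1) * (E σ π : ℤ)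
      - ∑ l ∈ Ico σ π, mu σ l * ∑ τ ∈ Icc l π, (-1 : ℤ) ^ (π.1 - τ.1) * (E τ π : ℤ) := by
  by_cases h : Le σ π
  · have key := sum_mu_mul_sum_Icc h (fun τ => (-1 : ℤ) ^ (π.1 - τ.1) * (E τ π : ℤ))
    rw [sum_Icc_eq_add_sum_Ico h, Icc_self, Finset.sum_singleton, E_self] at key
    simp only [Nat.sub_self, pow_zero, Nat.cast_one, mul_one] at key
    exact eq_sub_of_add_eq key
  · have hempty : Ico σ π = ∅ := Finset.eq_empty_of_forall_notMem fun l hl =>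
      h ((mem_Ico.mp hl).1.trans (mem_Ico.mp hl).2.1)
    rw [mu_of_not_le h, E_of_not_le h, hempty]
    simp

end PPerm

end
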